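/- Let A be a right weak bimonoid in a duoidal category (M,∘,I,•,J). Then for all objects X, Y of M: κ_{X,Y}.((κ_{J,A}•X)∘(A•Y)).(((J∘A∘(Δ.η))•X)∘(A•Y)) = κ_{X,Y} as morphisms ((J∘A)•X)∘(A•Y) → X∘Y, where κ_{J,A} : (J∘A)∘(A•A) → J∘A (using J•-unit isomorphisms) and J∘A∘(Δ.η) : J∘A → J∘A∘(A•A). -/

import Mathlib

open CategoryTheory

universe v u

/-- A (strict) duoidal category structure on a category `M`: two strict monoidal
structures `co` (the first monoidal product `∘` with unit `uI`) and `bu` (the second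
monoidal product `•` with unit `uJ`), together with the structure morphisms
`dlI : I ⟶ I • I`, `pw : J ∘ J ⟶ J`, `tau : I ⟶ J` and the interchange law `zt`,
subject to the axioms of a duoidal category. -/
structure Duo (M : Type u) [Category.{v} M] where
  co : M → M → M
  coh : ∀ {X₁ Y₁ X₂ Y₂ : M}, (X₁ ⟶ Y₁) → (X₂ ⟶ Y₂) → (co X₁ X₂ ⟶ co Y₁ Y₂)
  uI : M
  bu : M → M → M
  buh : ∀ {X₁ Y₁ X₂ Y₂ : M}, (X₁ ⟶ Y₁) → (X₂ ⟶ Y₂) → (bu X₁ X₂ ⟶ bu Y₁ Y₂)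
  uJ : M
  coA : ∀ X Y Z, co (co X Y) Z = co X (co Y Z)
  coL : ∀ X, co uI X = X
  coR : ∀ X, co X uI = X
  buA : ∀ X Y Z, bu (bu X Y) Z = bu X (bu Y Z)
  buL : ∀ X, bu uJ X = X
  buR : ∀ X, bu X uJ = X
  coh_id : ∀ X Y, coh (𝟙 X) (𝟙 Y) = 𝟙 (co X Y)
  coh_comp : ∀ {X₁ Y₁ Z₁ X₂ Y₂ Z₂ : M} (f₁ : X₁ ⟶ Y₁) (g₁ : Y₁ ⟶ Z₁) (f₂ : X₂ ⟶ Y₂)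
    (g₂ : Y₂ ⟶ Z₂), coh (f₁ ≫ g₁) (f₂ ≫ g₂) = coh f₁ f₂ ≫ coh g₁ g₂
  buh_id : ∀ X Y, buh (𝟙 X) (𝟙 Y) = 𝟙 (bu X Y)
  buh_comp : ∀ {X₁ Y₁ Z₁ X₂ Y₂ Z₂ : M} (f₁ : X₁ ⟶ Y₁) (g₁ : Y₁ ⟶ Z₁) (f₂ : X₂ ⟶ Y₂)
    (g₂ : Y₂ ⟶ Z₂), buh (f₁ ≫ g₁) (f₂ ≫ g₂) = buh f₁ f₂ ≫ buh g₁ g₂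
  coh_assoc : ∀ {X₁ Y₁ X₂ Y₂ X₃ Y₃ : M} (f₁ : X₁ ⟶ Y₁) (f₂ : X₂ ⟶ Y₂) (f₃ : X₃ ⟶ Y₃),
    coh (coh f₁ f₂) f₃
      = eqToHom (coA X₁ X₂ X₃) ≫ coh f₁ (coh f₂ f₃) ≫ eqToHom (coA Y₁ Y₂ Y₃).symm
  coh_unitL : ∀ {X Y : M} (f : X ⟶ Y),
    coh (𝟙 uI) f = eqToHom (coL X) ≫ f ≫ eqToHom (coL Y).symm
  coh_unitR : ∀ {X Y : M} (f : X ⟶ Y),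
    coh f (𝟙 uI) = eqToHom (coR X) ≫ f ≫ eqToHom (coR Y).symm
  buh_assoc : ∀ {X₁ Y₁ X₂ Y₂ X₃ Y₃ : M} (f₁ : X₁ ⟶ Y₁) (f₂ : X₂ ⟶ Y₂) (f₃ : X₃ ⟶ Y₃),
    buh (buh f₁ f₂) f₃
      = eqToHom (buA X₁ X₂ X₃) ≫ buh f₁ (buh f₂ f₃) ≫ eqToHom (buA Y₁ Y₂ Y₃).symm
  buh_unitL : ∀ {X Y : M} (f : X ⟶ Y),
    buh (𝟙 uJ) f = eqToHom (buL X) ≫ f ≫ eqToHom (buL Y).symm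
  buh_unitR : ∀ {X Y : M} (f : X ⟶ Y),
    buh f (𝟙 uJ) = eqToHom (buR X) ≫ f ≫ eqToHom (buR Y).symm
  dlI : uI ⟶ bu uI uI
  pw : co uJ uJ ⟶ uJ
  tau : uI ⟶ uJ
  zt : ∀ A B C D : M, co (bu A B) (bu C D) ⟶ bu (co A C) (co B D)
  zt_nat : ∀ {A A' B B' C C' D D' : M} (f : A ⟶ A') (g : B ⟶ B') (h : C ⟶ C')
    (k : D ⟶ D'),
    coh (buh f g) (buh h k) ≫ zt A' B' C' D' = zt A B C D ≫ buh (coh f h) (coh g k)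
  pw_assoc : coh pw (𝟙 uJ) ≫ pw = eqToHom (coA uJ uJ uJ) ≫ coh (𝟙 uJ) pw ≫ pw
  pw_unitL : eqToHom (coL uJ).symm ≫ coh tau (𝟙 uJ) ≫ pw = 𝟙 uJ
  pw_unitR : eqToHom (coR uJ).symm ≫ coh (𝟙 uJ) tau ≫ pw = 𝟙 uJ
  dlI_coassoc : dlI ≫ buh dlI (𝟙 uI) ≫ eqToHom (buA uI uI uI) = dlI ≫ buh (𝟙 uI) dlI
  dlI_counitL : dlI ≫ buh tau (𝟙 uI) ≫ eqToHom (buL uI) = 𝟙 uI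
  dlI_counitR : dlI ≫ buh (𝟙 uI) tau ≫ eqToHom (buR uI) = 𝟙 uI
  zt_assoc1 : ∀ A B C D E F : M,
    coh (zt A B C D) (𝟙 (bu E F)) ≫ zt (co A C) (co B D) E F
      = eqToHom (coA (bu A B) (bu C D) (bu E F)) ≫ coh (𝟙 (bu A B)) (zt C D E F)
          ≫ zt A B (co C E) (co D F)
          ≫ eqToHom (show bu (co A (co C E)) (co B (co D F))
              = bu (co (co A C) E) (co (co B D) F) by simp [coA])
  zt_assoc2 : ∀ A B C D E F : M,
    zt (bu A B) C (bu D E) F ≫ buh (zt A B D E) (𝟙 (co C F))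
      = eqToHom (show co (bu (bu A B) C) (bu (bu D E) F)
            = co (bu A (bu B C)) (bu D (bu E F)) by simp [buA])
          ≫ zt A (bu B C) D (bu E F) ≫ buh (𝟙 (co A D)) (zt B C E F)
          ≫ eqToHom (buA (co A D) (co B E) (co C F)).symm
  zt_unitA : ∀ A B : M,
    eqToHom (coL (bu A B)).symm ≫ coh dlI (𝟙 (bu A B)) ≫ zt uI uI A B
      ≫ eqToHom (show bu (co uI A) (co uI B) = bu A B by simp [coL]) = 𝟙 (bu A B)
  zt_unitB : ∀ A B : M,
    eqToHom (coR (bu A B)).symm ≫ coh (𝟙 (bu A B)) dlI ≫ zt A B uI uI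
      ≫ eqToHom (show bu (co A uI) (co B uI) = bu A B by simp [coR]) = 𝟙 (bu A B)
  zt_unitC : ∀ A B : M,
    eqToHom (show co A B = co (bu uJ A) (bu uJ B) by simp [buL]) ≫ zt uJ A uJ B
      ≫ buh pw (𝟙 (co A B)) ≫ eqToHom (buL (co A B)) = 𝟙 (co A B)
  zt_unitD : ∀ A B : M,
    eqToHom (show co A B = co (bu A uJ) (bu B uJ) by simp [buR]) ≫ zt A uJ B uJ
      ≫ buh (𝟙 (co A B)) pw ≫ eqToHom (buR (co A B)) = 𝟙 (co A B)

namespace Duo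

variable {M : Type u} [Category.{v} M] (D : Duo M)

/-- Axiom (WB): the multiplication is comultiplicative. -/
def WBeq (A : M) (mu : D.co A A ⟶ A) (dl : A ⟶ D.bu A A) : Prop :=
  mu ≫ dl = D.coh dl dl ≫ D.zt A A A A ≫ D.buh mu mu

/-- Axiom (RRU). -/
def RRUeq (A : M) (mu : D.co A A ⟶ A) (eta : D.uI ⟶ A) (dl : A ⟶ D.bu A A) : Prop :=
  D.dlI ≫ D.buh (𝟙 D.uI) (eta ≫ dl)
    ≫ eqToHom (show D.bu D.uI (D.bu A A) = D.bu (D.co (D.bu D.uI A) D.uI) A by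
        simp [D.coR, D.buA])
    ≫ D.buh (D.coh (𝟙 (D.bu D.uI A)) D.dlI) (𝟙 A)
    ≫ D.buh (D.coh (𝟙 (D.bu D.uI A)) (D.buh (𝟙 D.uI) (eta ≫ dl))) (𝟙 A)
    ≫ eqToHom (show D.bu (D.co (D.bu D.uI A) (D.bu D.uI (D.bu A A))) A
        = D.bu (D.co (D.bu D.uI A) (D.bu (D.bu D.uI A) A)) A by simp [D.buA])
    ≫ D.buh (D.zt D.uI A (D.bu D.uI A) A) (𝟙 A)
    ≫ eqToHom (show D.bu (D.bu (D.co D.uI (D.bu D.uI A)) (D.co A A)) A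
        = D.bu (D.bu (D.bu D.uI A) (D.co A A)) A by simp [D.coL])
    ≫ D.buh (D.buh (𝟙 (D.bu D.uI A)) mu) (𝟙 A)
  = D.dlI ≫ D.buh (𝟙 D.uI) eta ≫ D.buh (𝟙 D.uI) dl
    ≫ eqToHom (show D.bu D.uI (D.bu A A) = D.bu (D.bu D.uI A) A by simp [D.buA])
    ≫ D.buh (𝟙 (D.bu D.uI A)) dl
    ≫ eqToHom (show D.bu (D.bu D.uI A) (D.bu A A)
        = D.bu (D.bu (D.bu D.uI A) A) A by simp [D.buA])

/-- Axiom (LRU). -/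
def LRUeq (A : M) (mu : D.co A A ⟶ A) (eta : D.uI ⟶ A) (dl : A ⟶ D.bu A A) : Prop :=
  D.dlI ≫ D.buh (eta ≫ dl) (𝟙 D.uI)
    ≫ eqToHom (show D.bu (D.bu A A) D.uI = D.bu A (D.co (D.bu A D.uI) D.uI) by
        simp [D.coR, D.buA])
    ≫ D.buh (𝟙 A) (D.coh (𝟙 (D.bu A D.uI)) D.dlI)
    ≫ D.buh (𝟙 A) (D.coh (𝟙 (D.bu A D.uI)) (D.buh (eta ≫ dl) (𝟙 D.uI)))
    ≫ eqToHom (show D.bu A (D.co (D.bu A D.uI) (D.bu (D.bu A A) D.uI))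
        = D.bu A (D.co (D.bu A D.uI) (D.bu A (D.bu A D.uI))) by simp [D.buA])
    ≫ D.buh (𝟙 A) (D.zt A D.uI A (D.bu A D.uI))
    ≫ eqToHom (show D.bu A (D.bu (D.co A A) (D.co D.uI (D.bu A D.uI)))
        = D.bu (D.bu (D.bu A (D.co A A)) A) D.uI by simp [D.coL, D.buA])
    ≫ D.buh (D.buh (D.buh (𝟙 A) mu) (𝟙 A)) (𝟙 D.uI)
  = D.dlI ≫ D.buh eta (𝟙 D.uI) ≫ D.buh dl (𝟙 D.uI) ≫ D.buh (D.buh dl (𝟙 A)) (𝟙 D.uI)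

/-- Axiom (LRC). -/
def LRCeq (A : M) (mu : D.co A A ⟶ A) (dl : A ⟶ D.bu A A) (ep : A ⟶ D.uJ) : Prop :=
  D.coh (D.coh (𝟙 (D.co D.uJ A)) dl) (𝟙 A)
    ≫ eqToHom (show D.co (D.co (D.co D.uJ A) (D.bu A A)) A
        = D.co (D.co (D.bu (D.co D.uJ A) D.uJ) (D.bu A A)) A by simp [D.buR])
    ≫ D.coh (D.zt (D.co D.uJ A) D.uJ A A) (𝟙 A)
    ≫ D.coh (D.buh (eqToHom (D.coA D.uJ A A) ≫ D.coh (𝟙 D.uJ) (mu ≫ ep))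
        (𝟙 (D.co D.uJ A))) (𝟙 A)
    ≫ D.coh (D.buh D.pw (𝟙 (D.co D.uJ A))) (𝟙 A)
    ≫ eqToHom (show D.co (D.bu D.uJ (D.co D.uJ A)) A = D.co D.uJ (D.co A A) by
        simp [D.buL, D.coA])
    ≫ D.coh (𝟙 D.uJ) (mu ≫ ep) ≫ D.pw
  = eqToHom (show D.co (D.co (D.co D.uJ A) A) A = D.co (D.co D.uJ A) (D.co A A) by
        simp [D.coA])
    ≫ D.coh (𝟙 (D.co D.uJ A)) mu
    ≫ eqToHom (D.coA D.uJ A A)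
    ≫ D.coh (𝟙 D.uJ) mu ≫ D.coh (𝟙 D.uJ) ep ≫ D.pw

/-- Axiom (LLC). -/
def LLCeq (A : M) (mu : D.co A A ⟶ A) (dl : A ⟶ D.bu A A) (ep : A ⟶ D.uJ) : Prop :=
  D.coh (D.coh (𝟙 (D.co D.uJ A)) dl) (𝟙 A)
    ≫ eqToHom (show D.co (D.co (D.co D.uJ A) (D.bu A A)) A
        = D.co (D.co (D.bu D.uJ (D.co D.uJ A)) (D.bu A A)) A by simp [D.buL])
    ≫ D.coh (D.zt D.uJ (D.co D.uJ A) A A) (𝟙 A)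
    ≫ D.coh (D.buh (𝟙 (D.co D.uJ A))
        (eqToHom (D.coA D.uJ A A) ≫ D.coh (𝟙 D.uJ) (mu ≫ ep))) (𝟙 A)
    ≫ D.coh (D.buh (𝟙 (D.co D.uJ A)) D.pw) (𝟙 A)
    ≫ eqToHom (show D.co (D.bu (D.co D.uJ A) D.uJ) A = D.co D.uJ (D.co A A) by
        simp [D.buR, D.coA])
    ≫ D.coh (𝟙 D.uJ) (mu ≫ ep) ≫ D.pw
  = eqToHom (show D.co (D.co (D.co D.uJ A) A) A = D.co (D.co D.uJ A) (D.co A A) by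
        simp [D.coA])
    ≫ D.coh (𝟙 (D.co D.uJ A)) mu
    ≫ eqToHom (D.coA D.uJ A A)
    ≫ D.coh (𝟙 D.uJ) mu ≫ D.coh (𝟙 D.uJ) ep ≫ D.pw

/-- Axiom (RLU), obtained from (RRU) by replacing `∘` by its opposite. -/
def RLUeq (A : M) (mu : D.co A A ⟶ A) (eta : D.uI ⟶ A) (dl : A ⟶ D.bu A A) : Prop :=
  D.dlI ≫ D.buh (𝟙 D.uI) (eta ≫ dl)
    ≫ eqToHom (show D.bu D.uI (D.bu A A) = D.bu (D.co D.uI (D.bu D.uI A)) A by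
        simp [D.coL, D.buA])
    ≫ D.buh (D.coh D.dlI (𝟙 (D.bu D.uI A))) (𝟙 A)
    ≫ D.buh (D.coh (D.buh (𝟙 D.uI) (eta ≫ dl)) (𝟙 (D.bu D.uI A))) (𝟙 A)
    ≫ eqToHom (show D.bu (D.co (D.bu D.uI (D.bu A A)) (D.bu D.uI A)) A
        = D.bu (D.co (D.bu (D.bu D.uI A) A) (D.bu D.uI A)) A by simp [D.buA])
    ≫ D.buh (D.zt (D.bu D.uI A) A D.uI A) (𝟙 A)
    ≫ eqToHom (show D.bu (D.bu (D.co (D.bu D.uI A) D.uI) (D.co A A)) A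
        = D.bu (D.bu (D.bu D.uI A) (D.co A A)) A by simp [D.coR])
    ≫ D.buh (D.buh (𝟙 (D.bu D.uI A)) mu) (𝟙 A)
  = D.dlI ≫ D.buh (𝟙 D.uI) eta ≫ D.buh (𝟙 D.uI) dl
    ≫ eqToHom (show D.bu D.uI (D.bu A A) = D.bu (D.bu D.uI A) A by simp [D.buA])
    ≫ D.buh (𝟙 (D.bu D.uI A)) dl
    ≫ eqToHom (show D.bu (D.bu D.uI A) (D.bu A A)
        = D.bu (D.bu (D.bu D.uI A) A) A by simp [D.buA])

/-- Axiom (LLU), obtained from (LRU) by replacing `∘` by its opposite. -/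
def LLUeq (A : M) (mu : D.co A A ⟶ A) (eta : D.uI ⟶ A) (dl : A ⟶ D.bu A A) : Prop :=
  D.dlI ≫ D.buh (eta ≫ dl) (𝟙 D.uI)
    ≫ eqToHom (show D.bu (D.bu A A) D.uI = D.bu A (D.co D.uI (D.bu A D.uI)) by
        simp [D.coL, D.buA])
    ≫ D.buh (𝟙 A) (D.coh D.dlI (𝟙 (D.bu A D.uI)))
    ≫ D.buh (𝟙 A) (D.coh (D.buh (eta ≫ dl) (𝟙 D.uI)) (𝟙 (D.bu A D.uI)))
    ≫ eqToHom (show D.bu A (D.co (D.bu (D.bu A A) D.uI) (D.bu A D.uI))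
        = D.bu A (D.co (D.bu A (D.bu A D.uI)) (D.bu A D.uI)) by simp [D.buA])
    ≫ D.buh (𝟙 A) (D.zt A (D.bu A D.uI) A D.uI)
    ≫ eqToHom (show D.bu A (D.bu (D.co A A) (D.co (D.bu A D.uI) D.uI))
        = D.bu (D.bu (D.bu A (D.co A A)) A) D.uI by simp [D.coR, D.buA])
    ≫ D.buh (D.buh (D.buh (𝟙 A) mu) (𝟙 A)) (𝟙 D.uI)
  = D.dlI ≫ D.buh eta (𝟙 D.uI) ≫ D.buh dl (𝟙 D.uI) ≫ D.buh (D.buh dl (𝟙 A)) (𝟙 D.uI)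

/-- Axiom (RRC), obtained from (LLC) by replacing `∘` by its opposite. -/
def RRCeq (A : M) (mu : D.co A A ⟶ A) (dl : A ⟶ D.bu A A) (ep : A ⟶ D.uJ) : Prop :=
  D.coh (D.coh (D.coh (𝟙 A) dl) (𝟙 A)) (𝟙 D.uJ)
    ≫ eqToHom (show D.co (D.co (D.co A (D.bu A A)) A) D.uJ
        = D.co A (D.co (D.bu A A) (D.bu (D.co A D.uJ) D.uJ)) by simp [D.coA, D.buR])
    ≫ D.coh (𝟙 A) (D.zt A A (D.co A D.uJ) D.uJ)
    ≫ D.coh (𝟙 A) (D.buh (eqToHom (D.coA A A D.uJ).symm ≫ D.coh (mu ≫ ep) (𝟙 D.uJ))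
        (𝟙 (D.co A D.uJ)))
    ≫ D.coh (𝟙 A) (D.buh D.pw (𝟙 (D.co A D.uJ)))
    ≫ eqToHom (show D.co A (D.bu D.uJ (D.co A D.uJ)) = D.co (D.co A A) D.uJ by
        simp [D.buL, D.coA])
    ≫ D.coh (mu ≫ ep) (𝟙 D.uJ) ≫ D.pw
  = D.coh (D.coh mu (𝟙 A)) (𝟙 D.uJ) ≫ D.coh mu (𝟙 D.uJ) ≫ D.coh ep (𝟙 D.uJ) ≫ D.pw

/-- Axiom (RLC), obtained from (LRC) by replacing `∘` by its opposite. -/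
def RLCeq (A : M) (mu : D.co A A ⟶ A) (dl : A ⟶ D.bu A A) (ep : A ⟶ D.uJ) : Prop :=
  D.coh (D.coh (D.coh (𝟙 A) dl) (𝟙 A)) (𝟙 D.uJ)
    ≫ eqToHom (show D.co (D.co (D.co A (D.bu A A)) A) D.uJ
        = D.co A (D.co (D.bu A A) (D.bu D.uJ (D.co A D.uJ))) by simp [D.coA, D.buL])
    ≫ D.coh (𝟙 A) (D.zt A A D.uJ (D.co A D.uJ))
    ≫ D.coh (𝟙 A) (D.buh (𝟙 (D.co A D.uJ))
        (eqToHom (D.coA A A D.uJ).symm ≫ D.coh (mu ≫ ep) (𝟙 D.uJ)))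
    ≫ D.coh (𝟙 A) (D.buh (𝟙 (D.co A D.uJ)) D.pw)
    ≫ eqToHom (show D.co A (D.bu (D.co A D.uJ) D.uJ) = D.co (D.co A A) D.uJ by
        simp [D.buR, D.coA])
    ≫ D.coh (mu ≫ ep) (𝟙 D.uJ) ≫ D.pw
  = D.coh (D.coh mu (𝟙 A)) (𝟙 D.uJ) ≫ D.coh mu (𝟙 D.uJ) ≫ D.coh ep (𝟙 D.uJ) ≫ D.pw

end Duo

/-- A right weak bimonoid in a duoidal category. -/
structure RWB {M : Type u} [Category.{v} M] (D : Duo M) where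
  A : M
  mu : D.co A A ⟶ A
  eta : D.uI ⟶ A
  dl : A ⟶ D.bu A A
  ep : A ⟶ D.uJ
  mu_assoc : D.coh mu (𝟙 A) ≫ mu = eqToHom (D.coA A A A) ≫ D.coh (𝟙 A) mu ≫ mu
  mu_unitL : eqToHom (D.coL A).symm ≫ D.coh eta (𝟙 A) ≫ mu = 𝟙 A
  mu_unitR : eqToHom (D.coR A).symm ≫ D.coh (𝟙 A) eta ≫ mu = 𝟙 A
  dl_coassoc : dl ≫ D.buh dl (𝟙 A) ≫ eqToHom (D.buA A A A) = dl ≫ D.buh (𝟙 A) dl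
  dl_counitL : dl ≫ D.buh ep (𝟙 A) ≫ eqToHom (D.buL A) = 𝟙 A
  dl_counitR : dl ≫ D.buh (𝟙 A) ep ≫ eqToHom (D.buR A) = 𝟙 A
  wb : D.WBeq A mu dl
  rru : D.RRUeq A mu eta dl
  lru : D.LRUeq A mu eta dl
  lrc : D.LRCeq A mu dl ep
  llc : D.LLCeq A mu dl ep

/-- A weak bimonoid: both a right weak bimonoid and a left weak bimonoid. -/
structure WBim {M : Type u} [Category.{v} M] (D : Duo M) extends RWB D where
  rlu : D.RLUeq A mu eta dl
  llu : D.LLUeq A mu eta dl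
  rlc : D.RLCeq A mu dl ep
  rrc : D.RRCeq A mu dl ep

/-- Idempotent morphisms split in `M`. -/
def SplitIdem (M : Type u) [Category.{v} M] : Prop :=
  ∀ ⦃X : M⦄ (e : X ⟶ X), e ≫ e = e →
    ∃ (Y : M) (p : X ⟶ Y) (i : Y ⟶ X), p ≫ i = e ∧ i ≫ p = 𝟙 Y

namespace RWB

variable {M : Type u} [Category.{v} M] {D : Duo M} (W : RWB D)

/-- The object `J∘A`. -/
def JA : M := D.co D.uJ W.A

/-- The morphism `κ_{X,Y} = (ϖ•(X∘Y)).((J∘(ε.μ))•(X∘Y)).ζ :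
`((J∘A)•X)∘(A•Y) ⟶ X∘Y` of Lemma 1.4. -/
def kap (X Y : M) : D.co (D.bu W.JA X) (D.bu W.A Y) ⟶ D.co X Y :=
  D.zt W.JA X W.A Y
    ≫ D.buh (eqToHom (D.coA D.uJ W.A W.A) ≫ D.coh (𝟙 D.uJ) (W.mu ≫ W.ep))
        (𝟙 (D.co X Y))
    ≫ D.buh D.pw (𝟙 (D.co X Y))
    ≫ eqToHom (D.buL (D.co X Y))

end RWB

namespace Duo

variable {M : Type u} [Category.{v} M] (D : Duo M)

theorem coh_eqToHom_id {X Y : M} (h : X = Y) (Z : M) :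
    D.coh (eqToHom h) (𝟙 Z) = eqToHom (by rw [h]) := by
  subst h
  simp [D.coh_id]

theorem coh_id_eqToHom {X Y : M} (h : X = Y) (Z : M) :
    D.coh (𝟙 Z) (eqToHom h) = eqToHom (by rw [h]) := by
  subst h
  simp [D.coh_id]

theorem comp_coh_id {X Y Z : M} (f : X ⟶ Y) (g : Y ⟶ Z) (B : M) :
    D.coh (f ≫ g) (𝟙 B) = D.coh f (𝟙 B) ≫ D.coh g (𝟙 B) := by
  rw [← D.coh_comp, Category.comp_id]

theorem id_coh_comp {X Y Z : M} (f : X ⟶ Y) (g : Y ⟶ Z) (B : M) :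
    D.coh (𝟙 B) (f ≫ g) = D.coh (𝟙 B) f ≫ D.coh (𝟙 B) g := by
  rw [← D.coh_comp, Category.comp_id]

theorem comp_buh_id {X Y Z : M} (f : X ⟶ Y) (g : Y ⟶ Z) (B : M) :
    D.buh (f ≫ g) (𝟙 B) = D.buh f (𝟙 B) ≫ D.buh g (𝟙 B) := by
  rw [← D.buh_comp, Category.comp_id]

end Duo

namespace RWB

variable {M : Type u} [Category.{v} M] {D : Duo M} (W : RWB D)

/-- The pairing `ϖ.(J∘(ε.μ)) : J∘A∘A ⟶ J`. -/
def pairing : D.co W.JA W.A ⟶ D.uJ :=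
  eqToHom (D.coA D.uJ W.A W.A) ≫ D.coh (𝟙 D.uJ) (W.mu ≫ W.ep) ≫ D.pw

theorem kap_eq_pairing (X Y : M) :
    W.kap X Y = D.zt W.JA X W.A Y ≫ D.buh W.pairing (𝟙 (D.co X Y))
      ≫ eqToHom (D.buL (D.co X Y)) := by
  simp only [kap, pairing, D.comp_buh_id, Category.assoc]

/-- The morphism `κ_{J,A}.(J∘A∘Δ) : J∘A∘A ⟶ J∘A`. -/
def coact : D.co W.JA W.A ⟶ W.JA :=
  D.coh (𝟙 W.JA) W.dl
    ≫ eqToHom (show D.co W.JA (D.bu W.A W.A)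
        = D.co (D.bu W.JA D.uJ) (D.bu W.A W.A) by simp [D.buR])
    ≫ W.kap D.uJ W.A

theorem coact_pairing :
    D.coh W.coact (𝟙 W.A) ≫ W.pairing
      = eqToHom (D.coA W.JA W.A W.A) ≫ D.coh (𝟙 W.JA) W.mu ≫ W.pairing := by
  have h := W.lrc
  simp only [Duo.LRCeq] at h
  simp only [coact, pairing, kap, JA, D.comp_coh_id, D.id_coh_comp, D.comp_buh_id,
    D.coh_eqToHom_id, Category.assoc, eqToHom_trans_assoc] at h ⊢
  convert h using 3
  exact D.coh_eqToHom_id _ _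

theorem unit_mul :
    D.coh (eqToHom (D.coR W.JA).symm ≫ D.coh (𝟙 W.JA) W.eta) (𝟙 W.A)
      ≫ eqToHom (D.coA W.JA W.A W.A) ≫ D.coh (𝟙 W.JA) W.mu = 𝟙 _ := by
  have h := congrArg (D.coh (𝟙 W.JA)) W.mu_unitL
  simp only [D.id_coh_comp, D.coh_id_eqToHom, D.coh_id] at h
  simpa [D.comp_coh_id, D.coh_eqToHom_id, D.coh_assoc] using h

theorem counital_pairing :
    D.coh (eqToHom (D.coR W.JA).symm ≫ D.coh (𝟙 W.JA) W.eta ≫ W.coact) (𝟙 W.A) ≫ W.pairing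
      = W.pairing := by
  rw [← Category.assoc (eqToHom _), D.comp_coh_id _ W.coact, Category.assoc, W.coact_pairing]
  have h := W.unit_mul =≫ W.pairing
  simpa using h

theorem coh_buh_kap {e : W.JA ⟶ W.JA} (he : D.coh e (𝟙 W.A) ≫ W.pairing = W.pairing)
    (X Y : M) :
    D.coh (D.buh e (𝟙 X)) (𝟙 (D.bu W.A Y)) ≫ W.kap X Y = W.kap X Y := by
  rw [kap_eq_pairing, ← D.buh_id W.A Y, ← Category.assoc, D.zt_nat, D.coh_id, Category.assoc,
    ← Category.assoc (D.buh _ _), ← D.comp_buh_id, he]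

end RWB

/-- For a right weak bimonoid `A` in a duoidal category and all
objects `X, Y`:  `κ_{X,Y}.((κ_{J,A}•X)∘(A•Y)).(((J∘A∘(Δ.η))•X)∘(A•Y)) = κ_{X,Y}`
(part (3) of Lemma 1.4). -/
theorem kappa_idempotent_relation
    {M : Type u} [Category.{v} M] (D : Duo M) (W : RWB D) (X Y : M) :
    D.coh
        (D.buh
          (eqToHom (show W.JA = D.co W.JA D.uI by simp [D.coR])
            ≫ D.coh (𝟙 W.JA) (W.eta ≫ W.dl)
            ≫ eqToHom (show D.co W.JA (D.bu W.A W.A)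
                = D.co (D.bu W.JA D.uJ) (D.bu W.A W.A) by simp [D.buR])
            ≫ W.kap D.uJ W.A)
          (𝟙 X))
        (𝟙 (D.bu W.A Y))
      ≫ W.kap X Y
    = W.kap X Y := by
  refine W.coh_buh_kap ?_ X Y
  rw [D.id_coh_comp, Category.assoc]
  exact W.counital_pairing
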